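/- Exponential convergence of the continuous normalized gradient flow (Theorem 3.1): there exist δ > 0 and μ > 0 with the following property. Let ψ : [0,∞) × ℝ → ℝ satisfy: for each t, ψ(t,·) is even and twice differentiable with ψ(t,·), ∂ₓψ(t,·), ∂ₓₓψ(t,·) square-integrable; for each x, t ↦ ψ(t,x) is differentiable; the maps t ↦ ∫_ℝ ψ(t)·φ and t ↦ ∫_ℝ ∂ₓψ(t)·∂ₓφ are differentiable with derivative obtained by differentiating under the integral sign, for φ ∈ {ψ(t), η, ψ(t) − η}; ∫_ℝ ψ(0,x)² dx = 1; and ψ satisfies pointwise ∂ₜψ = (1/2)∂ₓₓψ + ψ³ + g(t)·ψ with g(t) = ∫_ℝ ( −(1/2)·∂ₓₓψ·ψ − ψ⁴ ) dx. If ‖ψ(0,·) − η‖_{H¹} ≤ δ, then there exists a constant C ≥ 0 such that ‖ψ(t,·) − η‖_{L²} ≤ C·e^{−μ·t} for all t ≥ 0. -/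

import Mathlib

open MeasureTheory

/-- The ground state `η(x) = (1/2) sech(x/2)`. -/
noncomputable def eta (x : ℝ) : ℝ := (1/2) * (1 / Real.cosh (x/2))

/-- Squared `H¹` norm: `‖f‖_{H¹}² = ∫ (f² + f'²)`. -/
noncomputable def H1sq (f : ℝ → ℝ) : ℝ := ∫ x : ℝ, ((f x)^2 + (deriv f x)^2)

open Filter Topology Set

/-- `f` is differentiable with derivative `f'`, and both are square-integrable. -/
def HasL2Deriv (f f' : ℝ → ℝ) : Prop :=
  (∀ x, HasDerivAt f (f' x) x) ∧ Integrable (fun x => f x ^ 2) ∧ Integrable (fun x => f' x ^ 2)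

lemma integrable_mul_of_sq {f g : ℝ → ℝ} (hf : Measurable f) (hg : Measurable g)
    (hf2 : Integrable fun x => f x ^ 2) (hg2 : Integrable fun x => g x ^ 2) :
    Integrable fun x => f x * g x :=
  ((memLp_two_iff_integrable_sq hf.aestronglyMeasurable).2 hf2).integrable_mul
    ((memLp_two_iff_integrable_sq hg.aestronglyMeasurable).2 hg2)

lemma integrable_sub_sq {f g : ℝ → ℝ} (hf : Measurable f) (hg : Measurable g)
    (hf2 : Integrable fun x => f x ^ 2) (hg2 : Integrable fun x => g x ^ 2) :
    Integrable fun x => (f x - g x) ^ 2 := by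
  have h := (hf2.add hg2).sub ((integrable_mul_of_sq hf hg hf2 hg2).const_mul 2)
  refine h.congr (Eventually.of_forall fun x => ?_)
  simp only [Pi.add_apply, Pi.sub_apply]
  ring

namespace HasL2Deriv

variable {f f' g g' : ℝ → ℝ}

lemma continuous (h : HasL2Deriv f f') : Continuous f :=
  continuous_iff_continuousAt.2 fun x => (h.1 x).continuousAt

lemma measurable (h : HasL2Deriv f f') : Measurable f := h.continuous.measurable

lemma measurable' (h : HasL2Deriv f f') : Measurable f' := by
  have : f' = deriv f := funext fun x => (h.1 x).deriv.symm
  rw [this]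
  exact measurable_deriv f

lemma sub (hf : HasL2Deriv f f') (hg : HasL2Deriv g g') :
    HasL2Deriv (fun x => f x - g x) (fun x => f' x - g' x) :=
  ⟨fun x => (hf.1 x).sub (hg.1 x),
    integrable_sub_sq hf.measurable hg.measurable hf.2.1 hg.2.1,
    integrable_sub_sq hf.measurable' hg.measurable' hf.2.2 hg.2.2⟩

lemma hasDerivAt_sq (h : HasL2Deriv f f') (x : ℝ) :
    HasDerivAt (fun x => f x ^ 2) (2 * (f x * f' x)) x := by
  refine ((h.1 x).pow 2).congr_deriv ?_
  push_cast
  ring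

lemma integrable_deriv_sq (h : HasL2Deriv f f') : Integrable fun x => 2 * (f x * f' x) :=
  (integrable_mul_of_sq h.measurable h.measurable' h.2.1 h.2.2).const_mul 2

lemma tendsto_sq (h : HasL2Deriv f f') : Tendsto (fun x => f x ^ 2) atTop (𝓝 0) :=
  tendsto_zero_of_hasDerivAt_of_integrableOn_Ioi (a := 0) (fun x _ => h.hasDerivAt_sq x)
    h.integrable_deriv_sq.integrableOn h.2.1.integrableOn

lemma tendsto (h : HasL2Deriv f f') : Tendsto f atTop (𝓝 0) := by
  have h1 := (Real.continuous_sqrt.tendsto 0).comp h.tendsto_sq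
  rw [Real.sqrt_zero] at h1
  refine squeeze_zero_norm (fun x => ?_) h1
  simp [Real.sqrt_sq_eq_abs]

/-- The one-dimensional Sobolev embedding. -/
lemma sq_le (h : HasL2Deriv f f') (x : ℝ) : f x ^ 2 ≤ (∫ y, f y ^ 2) + ∫ y, f' y ^ 2 := by
  have h1 := integral_Ioi_of_hasDerivAt_of_tendsto' (a := x) (fun y _ => h.hasDerivAt_sq y)
    h.integrable_deriv_sq.integrableOn h.tendsto_sq
  have h2 : -(∫ y in Ioi x, 2 * (f y * f' y)) ≤ ∫ y in Ioi x, (f y ^ 2 + f' y ^ 2) := by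
    rw [← integral_neg]
    refine setIntegral_mono h.integrable_deriv_sq.neg.integrableOn
      (h.2.1.add h.2.2).integrableOn fun y => ?_
    simp only
    nlinarith [sq_nonneg (f y + f' y)]
  have h3 : ∫ y in Ioi x, (f y ^ 2 + f' y ^ 2) ≤ ∫ y, (f y ^ 2 + f' y ^ 2) :=
    setIntegral_le_integral (h.2.1.add h.2.2) (Eventually.of_forall fun y => by positivity)
  rw [integral_add h.2.1 h.2.2] at h3
  linarith

lemma bounded (h : HasL2Deriv f f') : ∃ C, ∀ x, ‖f x‖ ≤ C :=
  ⟨_, fun x => Real.abs_le_sqrt (h.sq_le x)⟩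

lemma integrable_mul (hf : HasL2Deriv f f') (hg : HasL2Deriv g g') :
    Integrable fun x => f x * g x :=
  integrable_mul_of_sq hf.measurable hg.measurable hf.2.1 hg.2.1

lemma mul_integrable (hf : HasL2Deriv f f') {p : ℝ → ℝ} (hp : Integrable p) :
    Integrable fun x => f x * p x := by
  obtain ⟨C, hC⟩ := hf.bounded
  exact hp.bdd_mul hf.continuous.aestronglyMeasurable (Eventually.of_forall hC)

lemma integral_deriv_mul (hf : HasL2Deriv f f') (hg : HasL2Deriv g g') :
    ∫ x, f' x * g x = -∫ x, f x * g' x := by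
  have := integral_mul_deriv_eq_deriv_mul_of_integrable (u := f) (v := g) (u' := f') (v' := g')
    (fun x _ => hf.1 x) (fun x _ => hg.1 x)
    (integrable_mul_of_sq hf.measurable hg.measurable' hf.2.1 hg.2.2)
    (integrable_mul_of_sq hf.measurable' hg.measurable hf.2.2 hg.2.1)
    (hf.integrable_mul hg)
  linarith

end HasL2Deriv

lemma eta_pos (x : ℝ) : 0 < eta x := by
  have := Real.cosh_pos (x / 2)
  unfold eta
  positivity

lemma eta_le (x : ℝ) : eta x ≤ 1 / 2 := by
  have := Real.one_le_cosh (x / 2)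
  unfold eta
  have h : 1 / Real.cosh (x / 2) ≤ 1 := by
    rw [div_le_one (by linarith)]
    exact this
  linarith

lemma eta_neg (x : ℝ) : eta (-x) = eta x := by
  simp [eta, neg_div]

lemma tanh_sq_add (x : ℝ) : Real.tanh (x / 2) ^ 2 + 4 * eta x ^ 2 = 1 := by
  have h := Real.cosh_pos (x / 2)
  have h2 := Real.cosh_sq (x / 2)
  rw [Real.tanh_eq_sinh_div_cosh, eta]
  field_simp
  linarith

lemma hasDerivAt_tanh_half (x : ℝ) :
    HasDerivAt (fun x => Real.tanh (x / 2)) (2 * eta x ^ 2) x := by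
  have h := (Real.cosh_pos (x / 2)).ne'
  have hx : HasDerivAt (fun x : ℝ => x / 2) (1 / 2) x := (hasDerivAt_id x).div_const 2
  have h2 := Real.cosh_sq (x / 2)
  simp only [Real.tanh_eq_sinh_div_cosh]
  refine (hx.sinh.fun_div hx.cosh h).congr_deriv ?_
  rw [eta]
  field_simp
  linarith

lemma hasDerivAt_eta (x : ℝ) :
    HasDerivAt eta (-(1 / 2) * Real.tanh (x / 2) * eta x) x := by
  have h := (Real.cosh_pos (x / 2)).ne'
  have hx : HasDerivAt (fun x : ℝ => x / 2) (1 / 2) x := (hasDerivAt_id x).div_const 2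
  have e : eta = fun x : ℝ => 1 / 2 * (1 / Real.cosh (x / 2)) := rfl
  rw [e]
  refine (((hasDerivAt_const x (1 : ℝ)).fun_div hx.cosh h).const_mul (1 / 2)).congr_deriv ?_
  rw [Real.tanh_eq_sinh_div_cosh]
  field_simp
  ring

lemma tendsto_eta : Tendsto eta atTop (𝓝 0) := by
  have h : Tendsto (fun x : ℝ => Real.cosh (x / 2)) atTop atTop := by
    refine tendsto_atTop_mono (f := fun x : ℝ => x / 2) (fun x => ?_)
      (tendsto_id.atTop_div_const two_pos)
    have h4 := Real.cosh_pos (x / 2)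
    have h5 : x / 2 ≤ Real.sinh (x / 2) ∨ x / 2 < 0 := by
      by_cases hx : 0 ≤ x / 2
      · exact Or.inl (Real.self_le_sinh_iff.2 hx)
      · exact Or.inr (not_le.1 hx)
    rcases h5 with h5 | h5
    · exact h5.trans (Real.sinh_lt_cosh _).le
    · linarith
  have := (h.inv_tendsto_atTop).const_mul (1 / 2)
  refine (this.congr fun x => ?_).trans (by simp)
  simp [eta]

lemma tendsto_tanh_half : Tendsto (fun x : ℝ => Real.tanh (x / 2)) atTop (𝓝 1) := by
  have h : Tendsto (fun x => Real.sqrt (1 - 4 * eta x ^ 2)) atTop (𝓝 1) := by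
    have := ((tendsto_eta.pow 2).const_mul 4).const_sub 1
    have := (Real.continuous_sqrt.tendsto _).comp this
    simpa [Function.comp_def] using this
  refine h.congr' ?_
  filter_upwards [eventually_ge_atTop 0] with x hx
  have h0 : 0 ≤ Real.tanh (x / 2) := by
    rw [Real.tanh_eq_sinh_div_cosh]
    exact div_nonneg (Real.sinh_nonneg_iff.2 (by linarith)) (Real.cosh_pos _).le
  rw [← Real.sqrt_sq h0]
  congr 1
  linarith [tanh_sq_add x]

lemma tendsto_tanh_half_bot : Tendsto (fun x : ℝ => Real.tanh (x / 2)) atBot (𝓝 (-1)) := by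
  have := (tendsto_tanh_half.comp tendsto_neg_atBot_atTop).neg
  refine this.congr fun x => ?_
  simp [Function.comp, neg_div, Real.tanh_neg]

lemma continuous_eta : Continuous eta :=
  continuous_iff_continuousAt.2 fun x => (hasDerivAt_eta x).continuousAt

lemma integrable_eta_sq : Integrable fun x => eta x ^ 2 := by
  have h : IntegrableOn (fun x => 2 * eta x ^ 2) (Ioi 0) :=
    integrableOn_Ioi_deriv_of_nonneg' (fun x _ => hasDerivAt_tanh_half x)
      (fun x _ => by positivity) tendsto_tanh_half
  have h' : IntegrableOn (fun x => 2 * eta x ^ 2) (Iic 0) := by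
    rw [← integrableOn_Ici_iff_integrableOn_Ioi, ← neg_zero] at h
    simpa [eta_neg] using h.comp_neg_Iic
  have := (h'.union h)
  rw [Iic_union_Ioi, integrableOn_univ] at this
  have := this.const_mul (1 / 2)
  refine this.congr (Eventually.of_forall fun x => ?_)
  simp

lemma hasL2Deriv_eta : HasL2Deriv eta (fun x => -(1 / 2) * Real.tanh (x / 2) * eta x) := by
  refine ⟨hasDerivAt_eta, integrable_eta_sq, ?_⟩
  refine integrable_eta_sq.mono' ?_ (Eventually.of_forall fun x => ?_)
  · have : Continuous fun x => Real.tanh (x / 2) :=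
      continuous_iff_continuousAt.2 fun x => (hasDerivAt_tanh_half x).continuousAt
    exact (((continuous_const.mul this).mul continuous_eta).pow 2).aestronglyMeasurable
  · rw [Real.norm_of_nonneg (sq_nonneg _), mul_pow, mul_pow]
    have h := tanh_sq_add x
    nlinarith [sq_nonneg (eta x), mul_nonneg (sq_nonneg (eta x)) (sq_nonneg (eta x))]

lemma hasDerivAt_deriv_eta (x : ℝ) :
    HasDerivAt (fun x => -(1 / 2) * Real.tanh (x / 2) * eta x)
      (1 / 4 * eta x - 2 * eta x ^ 3) x := by
  refine (((hasDerivAt_tanh_half x).const_mul (-(1 / 2))).fun_mul (hasDerivAt_eta x)).congr_deriv ?_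
  have := tanh_sq_add x
  linear_combination (1 / 4 * eta x) * this

lemma integrable_eta_pow_four : Integrable fun x => eta x ^ 4 := by
  refine (hasL2Deriv_eta.mul_integrable (hasL2Deriv_eta.mul_integrable integrable_eta_sq)).congr
    (Eventually.of_forall fun x => ?_)
  simp only
  ring

lemma integral_eta_sq : ∫ x, eta x ^ 2 = 1 := by
  have := integral_of_hasDerivAt_of_tendsto hasDerivAt_tanh_half (integrable_eta_sq.const_mul 2)
    tendsto_tanh_half_bot tendsto_tanh_half
  rw [integral_const_mul] at this
  linarith

lemma integral_eta_pow_four : ∫ x, eta x ^ 4 = 1 / 6 := by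
  have h : ∀ x, HasDerivAt (fun x => Real.tanh (x / 2) - 1 / 3 * Real.tanh (x / 2) ^ 3)
      (8 * eta x ^ 4) x := fun x => by
    refine ((hasDerivAt_tanh_half x).fun_sub
      (((hasDerivAt_tanh_half x).fun_pow 3).const_mul (1 / 3))).congr_deriv ?_
    have := tanh_sq_add x
    push_cast
    linear_combination (-2 * eta x ^ 2) * this
  have := integral_of_hasDerivAt_of_tendsto h (integrable_eta_pow_four.const_mul 8)
    (tendsto_tanh_half_bot.sub ((tendsto_tanh_half_bot.pow 3).const_mul (1 / 3)))
    (tendsto_tanh_half.sub ((tendsto_tanh_half.pow 3).const_mul (1 / 3)))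
  rw [integral_const_mul] at this
  linarith


/-- The coefficient `α` of the square completing the linearized energy, as a function of
`tanh (x / 2)`. -/
noncomputable def sosAlpha (t : ℝ) : ℝ := (44 * t - 4 * t ^ 2 - t ^ 3 + 4 * t ^ 4 - 3 * t ^ 5) / 40

/-- The derivative of `sosAlpha`. -/
noncomputable def sosAlpha' (t : ℝ) : ℝ := (44 - 8 * t - 3 * t ^ 2 + 16 * t ^ 3 - 15 * t ^ 4) / 40

/-- The coefficient `γ` of the square completing the linearized energy, as a function of
`tanh (x / 2)`. -/
noncomputable def sosGamma (t : ℝ) : ℝ :=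
  (782 + 40 * t + 55 * t ^ 2 - 120 * t ^ 3 + 105 * t ^ 4) / 400

/-- The derivative of `sosGamma`. -/
noncomputable def sosGamma' (t : ℝ) : ℝ := (40 + 110 * t - 360 * t ^ 2 + 420 * t ^ 3) / 400

/-- The boundary coefficient produced by integrating the square by parts. -/
noncomputable def sosKappa (t : ℝ) : ℝ :=
  sosAlpha t * sosGamma t + t * sosGamma t - (1 - t ^ 2) * sosGamma' t

/-- The derivative of `sosKappa`. -/
noncomputable def sosKappa' (t : ℝ) : ℝ :=
  sosAlpha' t * sosGamma t + sosAlpha t * sosGamma' t + sosGamma t + 3 * t * sosGamma' t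
    - (1 - t ^ 2) * ((110 - 720 * t + 1260 * t ^ 2) / 400)

lemma hasDerivAt_sosAlpha (t : ℝ) : HasDerivAt sosAlpha (sosAlpha' t) t := by
  have h := ((((((hasDerivAt_id t).const_mul 44).sub ((hasDerivAt_pow 2 t).const_mul 4)).sub
    (hasDerivAt_pow 3 t)).add ((hasDerivAt_pow 4 t).const_mul 4)).sub
    ((hasDerivAt_pow 5 t).const_mul 3)).div_const 40
  refine h.congr_deriv ?_
  rw [sosAlpha']
  norm_num
  ring

lemma hasDerivAt_sosGamma (t : ℝ) : HasDerivAt sosGamma (sosGamma' t) t := by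
  have h := ((((((hasDerivAt_id t).const_mul 40).const_add 782).add
    ((hasDerivAt_pow 2 t).const_mul 55)).sub ((hasDerivAt_pow 3 t).const_mul 120)).add
    ((hasDerivAt_pow 4 t).const_mul 105)).div_const 400
  refine h.congr_deriv ?_
  rw [sosGamma']
  norm_num
  ring

lemma hasDerivAt_sosGamma' (t : ℝ) :
    HasDerivAt sosGamma' ((110 - 720 * t + 1260 * t ^ 2) / 400) t := by
  have h := (((((hasDerivAt_id t).const_mul 110).const_add 40).sub
    ((hasDerivAt_pow 2 t).const_mul 360)).add ((hasDerivAt_pow 3 t).const_mul 420)).div_const 400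
  refine h.congr_deriv ?_
  norm_num
  ring

lemma hasDerivAt_sosKappa (t : ℝ) : HasDerivAt sosKappa (sosKappa' t) t := by
  have h := (((hasDerivAt_sosAlpha t).mul (hasDerivAt_sosGamma t)).add
    ((hasDerivAt_id t).mul (hasDerivAt_sosGamma t))).sub
    (((hasDerivAt_pow 2 t).const_sub 1).mul (hasDerivAt_sosGamma' t))
  refine h.congr_deriv ?_
  rw [sosKappa']
  norm_num
  ring

lemma sosAlpha_ineq {t : ℝ} (h0 : 0 ≤ t) (h1 : t ≤ 1) :
    sosAlpha t ^ 2 - (1 - t ^ 2) * sosAlpha' t - 2 * (1 - t ^ 2) * sosGamma t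
      ≤ 1 - (6 + 1 / 400) * (1 - t ^ 2) := by
  have hu : 0 ≤ 1 - t := by linarith
  have hs : 0 ≤ 1 - t ^ 2 := by nlinarith
  rw [← sub_nonneg]
  have e : 1 - (6 + 1 / 400) * (1 - t ^ 2) - (sosAlpha t ^ 2 - (1 - t ^ 2) * sosAlpha' t
      - 2 * (1 - t ^ 2) * sosGamma t) = (1 - t ^ 2) *
      (3 / 400 * (1 - t) ^ 8 + 3 / 50 * t ^ 1 * (1 - t) ^ 7 + 1 / 5 * t ^ 2 * (1 - t) ^ 6
        + 19 / 50 * t ^ 3 * (1 - t) ^ 5 + 23 / 50 * t ^ 4 * (1 - t) ^ 4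
        + 71 / 200 * t ^ 5 * (1 - t) ^ 3 + 279 / 1600 * t ^ 6 * (1 - t) ^ 2
        + 39 / 800 * t ^ 7 * (1 - t) ^ 1 + 3 / 400 * t ^ 8) := by
    unfold sosAlpha sosAlpha' sosGamma
    ring
  rw [e]
  positivity

lemma sosGamma_ineq {t : ℝ} (h0 : 0 ≤ t) (h1 : t ≤ 1) : sosGamma t ^ 2 ≤ sosKappa' t := by
  have hu : 0 ≤ 1 - t := by linarith
  rw [← sub_nonneg]
  have e : sosKappa' t - sosGamma t ^ 2 = 339 / 40000 * (1 - t) ^ 13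
      + 69927 / 40000 * t ^ 1 * (1 - t) ^ 12 + 362681 / 20000 * t ^ 2 * (1 - t) ^ 11
      + 1645227 / 20000 * t ^ 3 * (1 - t) ^ 10 + 6728009 / 32000 * t ^ 4 * (1 - t) ^ 9
      + 52500117 / 160000 * t ^ 5 * (1 - t) ^ 8 + 25011393 / 80000 * t ^ 6 * (1 - t) ^ 7
      + 13185963 / 80000 * t ^ 7 * (1 - t) ^ 6 + 5166777 / 160000 * t ^ 8 * (1 - t) ^ 5
      + 140109 / 32000 * t ^ 9 * (1 - t) ^ 4 + 240321 / 10000 * t ^ 10 * (1 - t) ^ 3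
      + 970207 / 40000 * t ^ 11 * (1 - t) ^ 2 + 387057 / 40000 * t ^ 12 * (1 - t) ^ 1
      + 57709 / 40000 * t ^ 13 := by
    unfold sosKappa' sosAlpha sosAlpha' sosGamma sosGamma'
    ring
  rw [e]
  positivity

/-- The pointwise inequality behind the coercivity of the linearized energy: up to the exact
derivative on the left, the energy density is a square plus nonnegative terms. -/
lemma energy_density_ge {t n w v b : ℝ} (h0 : 0 ≤ t) (h1 : t ≤ 1) (hn : t ^ 2 + 4 * n ^ 2 = 1) :
    -(1 / 2) * (sosAlpha' t * (2 * n ^ 2) * w ^ 2 + sosAlpha t * (2 * w * v)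
      + 4 * ((-(1 / 2) * t * n) * sosGamma t * b * w + n * (sosGamma' t * (2 * n ^ 2)) * b * w
        + n * sosGamma t * (w * n) * w + n * sosGamma t * b * v)
      + (sosKappa' t * (2 * n ^ 2) * b ^ 2 + sosKappa t * (2 * b * (w * n))))
    ≤ v ^ 2 + 1 / 4 * w ^ 2 - (6 + 1 / 400) * (n ^ 2 * w ^ 2) := by
  have i1 := mul_le_mul_of_nonneg_right (sosAlpha_ineq h0 h1) (sq_nonneg w)
  have i2 := mul_le_mul_of_nonneg_right (sosGamma_ineq h0 h1) (sq_nonneg (2 * n * b))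
  have hs : 1 - t ^ 2 = 4 * n ^ 2 := by linarith
  rw [sosKappa]
  rw [hs] at i1 ⊢
  nlinarith [sq_nonneg (2 * v + sosAlpha t * w + 2 * n * sosGamma t * b)]

lemma coercive_Ioi {w v : ℝ → ℝ} (h : HasL2Deriv w v) :
    -3 * (∫ x in Ioi 0, w x * eta x) ^ 2
      ≤ ∫ x in Ioi 0, (v x ^ 2 + 1 / 4 * w x ^ 2 - (6 + 1 / 400) * (eta x ^ 2 * w x ^ 2)) := by
  set φ : ℝ → ℝ := fun x => v x ^ 2 + 1 / 4 * w x ^ 2 - (6 + 1 / 400) * (eta x ^ 2 * w x ^ 2)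
    with hφ
  set b : ℝ → ℝ := fun x => ∫ y in (0 : ℝ)..x, w y * eta y with hb
  set T : ℝ → ℝ := fun x => Real.tanh (x / 2) with hT
  have hbd : ∀ x, HasDerivAt b (w x * eta x) x := fun x =>
    ((h.continuous.mul continuous_eta).integral_hasStrictDerivAt 0 x).hasDerivAt
  have hblim : Tendsto b atTop (𝓝 (∫ x in Ioi 0, w x * eta x)) :=
    intervalIntegral_tendsto_integral_Ioi 0
      (h.integrable_mul hasL2Deriv_eta).integrableOn tendsto_id
  have hφi : Integrable φ := by
    refine (h.2.2.add (h.2.1.const_mul (1 / 4))).sub (Integrable.const_mul ?_ _)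
    refine (hasL2Deriv_eta.mul_integrable (hasL2Deriv_eta.mul_integrable h.2.1)).congr
      (Eventually.of_forall fun x => ?_)
    simp only
    ring
  set Z : ℝ → ℝ := fun x => -(1 / 2) * (sosAlpha (T x) * w x ^ 2
    + 4 * (eta x * sosGamma (T x) * b x * w x) + sosKappa (T x) * b x ^ 2) with hZ
  have hZd : ∀ x, HasDerivAt Z (-(1 / 2) * (sosAlpha' (T x) * (2 * eta x ^ 2) * w x ^ 2
      + sosAlpha (T x) * (2 * w x * v x)
      + 4 * ((-(1 / 2) * T x * eta x) * sosGamma (T x) * b x * w x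
        + eta x * (sosGamma' (T x) * (2 * eta x ^ 2)) * b x * w x
        + eta x * sosGamma (T x) * (w x * eta x) * w x + eta x * sosGamma (T x) * b x * v x)
      + (sosKappa' (T x) * (2 * eta x ^ 2) * b x ^ 2
        + sosKappa (T x) * (2 * b x * (w x * eta x))))) x := by
    intro x
    have dT : HasDerivAt T (2 * eta x ^ 2) x := hasDerivAt_tanh_half x
    have dα : HasDerivAt (fun y => sosAlpha (T y)) _ x := (hasDerivAt_sosAlpha (T x)).comp x dT
    have dγ : HasDerivAt (fun y => sosGamma (T y)) _ x := (hasDerivAt_sosGamma (T x)).comp x dT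
    have dκ : HasDerivAt (fun y => sosKappa (T y)) _ x := (hasDerivAt_sosKappa (T x)).comp x dT
    refine (((((dα.fun_mul ((h.1 x).fun_pow 2)).fun_add
      (((((hasDerivAt_eta x).fun_mul dγ).fun_mul (hbd x)).fun_mul (h.1 x)).const_mul 4)).fun_add
      (dκ.fun_mul ((hbd x).fun_pow 2))).const_mul (-(1 / 2)))).congr_deriv ?_
    push_cast
    ring
  have hkey : ∀ R, 0 ≤ R → Z R - Z 0 ≤ ∫ x in (0 : ℝ)..R, φ x := by
    intro R hR
    refine intervalIntegral.sub_le_integral_of_hasDeriv_right_of_le hR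
      (fun x _ => (hZd x).continuousAt.continuousWithinAt)
      (fun x _ => (hZd x).hasDerivWithinAt) hφi.integrableOn fun x hx => ?_
    have h0 : 0 ≤ T x := by
      simp only [hT, Real.tanh_eq_sinh_div_cosh]
      exact div_nonneg (Real.sinh_nonneg_iff.2 (by linarith [hx.1])) (Real.cosh_pos _).le
    exact energy_density_ge h0 (Real.tanh_lt_one _).le (tanh_sq_add x)
  have hZ0 : Z 0 = 0 := by
    simp [hZ, hb, hT, sosAlpha]
  have cα : Tendsto (fun x => sosAlpha (T x)) atTop (𝓝 (sosAlpha 1)) :=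
    (hasDerivAt_sosAlpha 1).continuousAt.tendsto.comp tendsto_tanh_half
  have cγ : Tendsto (fun x => sosGamma (T x)) atTop (𝓝 (sosGamma 1)) :=
    (hasDerivAt_sosGamma 1).continuousAt.tendsto.comp tendsto_tanh_half
  have cκ : Tendsto (fun x => sosKappa (T x)) atTop (𝓝 (sosKappa 1)) :=
    (hasDerivAt_sosKappa 1).continuousAt.tendsto.comp tendsto_tanh_half
  have hZlim := (((cα.mul (h.tendsto.pow 2)).add
    ((((tendsto_eta.mul cγ).mul hblim).mul h.tendsto).const_mul 4)).add
    (cκ.mul (hblim.pow 2))).const_mul (-(1 / 2))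
  have hφlim := intervalIntegral_tendsto_integral_Ioi 0 hφi.integrableOn tendsto_id
  have := le_of_tendsto_of_tendsto hZlim hφlim (by
    filter_upwards [eventually_ge_atTop 0] with R hR
    have := hkey R hR
    rw [hZ0, sub_zero] at this
    exact this)
  have hκ : sosKappa 1 ≤ 6 := by
    norm_num [sosKappa, sosAlpha, sosGamma]
  nlinarith [sq_nonneg (∫ x in Ioi 0, w x * eta x)]

/-- An even integrable quantity is twice its integral over the half-line. -/
lemma integral_eq_two_mul_of_even {f : ℝ → ℝ} (hf : ∀ x, f (-x) = f x) :
    ∫ x, f x = 2 * ∫ x in Ioi 0, f x := by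
  rw [← integral_comp_abs]
  congr 1
  funext x
  rcases abs_cases x with ⟨h, _⟩ | ⟨h, _⟩ <;> simp [h, hf]

lemma HasL2Deriv.deriv_neg {w v : ℝ → ℝ} (h : HasL2Deriv w v) (hw : ∀ x, w (-x) = w x) (x : ℝ) :
    v (-x) = -v x := by
  have h1 : HasDerivAt (fun y => w (-y)) (-v (-x)) x := by
    simpa [Function.comp_def] using (h.1 (-x)).comp x (hasDerivAt_neg x)
  simp only [hw] at h1
  linarith [h1.unique (h.1 x)]

lemma HasL2Deriv.integrable_eta_sq_mul_sq {w v : ℝ → ℝ} (h : HasL2Deriv w v) :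
    Integrable fun x => eta x ^ 2 * w x ^ 2 := by
  refine (hasL2Deriv_eta.mul_integrable (hasL2Deriv_eta.mul_integrable h.2.1)).congr
    (Eventually.of_forall fun x => ?_)
  simp only
  ring

/-- Coercivity of the linearized energy on even functions almost orthogonal to `η`. -/
lemma coercive {w v : ℝ → ℝ} (h : HasL2Deriv w v) (hw : ∀ x, w (-x) = w x) :
    ((∫ x, w x ^ 2) + ∫ x, v x ^ 2) / 10000 - 2 * (∫ x, w x * eta x) ^ 2
      ≤ (∫ x, v x ^ 2) + 1 / 4 * (∫ x, w x ^ 2) - 6 * ∫ x, eta x ^ 2 * w x ^ 2 := by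
  have h1 := coercive_Ioi h
  have e1 := integral_eq_two_mul_of_even (f := fun x => w x * eta x) fun x => by
    simp only [hw, eta_neg]
  have e2 := integral_eq_two_mul_of_even
    (f := fun x => v x ^ 2 + 1 / 4 * w x ^ 2 - (6 + 1 / 400) * (eta x ^ 2 * w x ^ 2)) fun x => by
      simp only [hw, eta_neg, h.deriv_neg hw, neg_sq]
  have e3 : ∫ x, (v x ^ 2 + 1 / 4 * w x ^ 2 - (6 + 1 / 400) * (eta x ^ 2 * w x ^ 2))
      = (∫ x, v x ^ 2) + 1 / 4 * (∫ x, w x ^ 2) - (6 + 1 / 400) * ∫ x, eta x ^ 2 * w x ^ 2 := by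
    have i : Integrable fun x => v x ^ 2 + 1 / 4 * w x ^ 2 := h.2.2.add (h.2.1.const_mul _)
    rw [integral_sub i (h.integrable_eta_sq_mul_sq.const_mul _),
      integral_add h.2.2 (h.2.1.const_mul _), integral_const_mul, integral_const_mul]
  have p1 : 0 ≤ ∫ x, w x ^ 2 := integral_nonneg fun x => sq_nonneg _
  have p2 : 0 ≤ ∫ x, v x ^ 2 := integral_nonneg fun x => sq_nonneg _
  have e4 : (∫ x, w x * eta x) ^ 2 = 4 * (∫ x in Ioi 0, w x * eta x) ^ 2 := by
    rw [e1]
    ring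
  linarith [sq_nonneg (∫ x, w x * eta x)]

lemma HasL2Deriv.integrable_mul₄ {f f' g g' p p' q q' : ℝ → ℝ} (hf : HasL2Deriv f f')
    (hg : HasL2Deriv g g') (hp : HasL2Deriv p p') (hq : HasL2Deriv q q') :
    Integrable fun x => f x * (g x * (p x * q x)) :=
  hf.mul_integrable (hg.mul_integrable (hp.integrable_mul hq))

lemma HasL2Deriv.integrable_eta_mul_cube {w v : ℝ → ℝ} (h : HasL2Deriv w v) :
    Integrable fun x => eta x * w x ^ 3 :=
  (hasL2Deriv_eta.integrable_mul₄ h h h).congr (Eventually.of_forall fun x => by simp only; ring)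

lemma HasL2Deriv.integrable_pow_four {w v : ℝ → ℝ} (h : HasL2Deriv w v) :
    Integrable fun x => w x ^ 4 :=
  (h.integrable_mul₄ h h h).congr (Eventually.of_forall fun x => by simp only; ring)

lemma HasL2Deriv.integrable_eta_cube_mul {w v : ℝ → ℝ} (h : HasL2Deriv w v) :
    Integrable fun x => eta x ^ 3 * w x :=
  (h.integrable_mul₄ hasL2Deriv_eta hasL2Deriv_eta hasL2Deriv_eta).congr
    (Eventually.of_forall fun x => by simp only; ring)

lemma HasL2Deriv.integral_pow_four_le {w v : ℝ → ℝ} (h : HasL2Deriv w v) :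
    ∫ x, w x ^ 4 ≤ ((∫ x, w x ^ 2) + ∫ x, v x ^ 2) * ∫ x, w x ^ 2 := by
  rw [← integral_const_mul]
  refine integral_mono h.integrable_pow_four (h.2.1.const_mul _) fun x => ?_
  have := mul_le_mul_of_nonneg_right (h.sq_le x) (sq_nonneg (w x))
  calc w x ^ 4 = w x ^ 2 * w x ^ 2 := by ring
    _ ≤ _ := this

lemma HasL2Deriv.abs_integral_eta_mul_cube_le {w v : ℝ → ℝ} (h : HasL2Deriv w v) {ε : ℝ}
    (hε : 0 < ε) (hm : ∫ x, w x ^ 2 ≤ ε ^ 2) :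
    |∫ x, eta x * w x ^ 3| ≤ ε * ((∫ x, w x ^ 2) + ∫ x, v x ^ 2) := by
  have hb : ∀ x, ‖eta x * w x ^ 3‖ ≤ ε / 2 * w x ^ 2 + 1 / (2 * ε) * w x ^ 4 := fun x => by
    rw [norm_mul, norm_pow, Real.norm_of_nonneg (eta_pos x).le, Real.norm_eq_abs]
    have h1 : |w x| ^ 3 ≤ ε / 2 * w x ^ 2 + 1 / (2 * ε) * w x ^ 4 := by
      rw [← sq_abs (w x), show w x ^ 4 = (w x ^ 2) ^ 2 by ring, ← sq_abs (w x), ← sub_nonneg]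
      have : ε / 2 * |w x| ^ 2 + 1 / (2 * ε) * (|w x| ^ 2) ^ 2 - |w x| ^ 3
          = 1 / (2 * ε) * (|w x| * (|w x| - ε)) ^ 2 := by
        field_simp
        ring
      rw [this]
      positivity
    have h2 : 0 ≤ |w x| ^ 3 := by positivity
    nlinarith [eta_pos x, eta_le x]
  have h1 := norm_integral_le_of_norm_le
    ((h.2.1.const_mul (ε / 2)).add (h.integrable_pow_four.const_mul (1 / (2 * ε))))
    (Eventually.of_forall hb)
  have e : ∫ x, (ε / 2 * w x ^ 2 + 1 / (2 * ε) * w x ^ 4)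
      = ε / 2 * (∫ x, w x ^ 2) + 1 / (2 * ε) * ∫ x, w x ^ 4 := by
    rw [integral_add (h.2.1.const_mul _) (h.integrable_pow_four.const_mul _), integral_const_mul,
      integral_const_mul]
  refine h1.trans (e.le.trans ?_)
  have p1 : 0 ≤ ∫ x, w x ^ 2 := integral_nonneg fun x => sq_nonneg _
  have p2 : 0 ≤ ∫ x, v x ^ 2 := integral_nonneg fun x => sq_nonneg _
  have h2 : 1 / (2 * ε) * ∫ x, w x ^ 4 ≤ ε / 2 * ((∫ x, w x ^ 2) + ∫ x, v x ^ 2) := by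
    have h3 : ∫ x, w x ^ 4 ≤ ((∫ x, w x ^ 2) + ∫ x, v x ^ 2) * ε ^ 2 :=
      h.integral_pow_four_le.trans (by gcongr)
    calc 1 / (2 * ε) * ∫ x, w x ^ 4
        ≤ 1 / (2 * ε) * (((∫ x, w x ^ 2) + ∫ x, v x ^ 2) * ε ^ 2) := by gcongr
      _ = ε / 2 * ((∫ x, w x ^ 2) + ∫ x, v x ^ 2) := by
        field_simp
  have h4 : 0 ≤ ε * ∫ x, v x ^ 2 := by positivity
  linarith

lemma HasL2Deriv.abs_integral_eta_cube_mul_le {w v : ℝ → ℝ} (h : HasL2Deriv w v) {ε : ℝ}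
    (hε : 0 < ε) (hm : ∫ x, w x ^ 2 ≤ ε ^ 2) : |∫ x, eta x ^ 3 * w x| ≤ ε := by
  have hb : ∀ x, ‖eta x ^ 3 * w x‖ ≤ ε / 2 * eta x ^ 2 + 1 / (2 * ε) * w x ^ 2 := fun x => by
    rw [norm_mul, norm_pow, Real.norm_of_nonneg (eta_pos x).le, Real.norm_eq_abs]
    have h0 := eta_pos x
    have h1 : eta x ^ 3 ≤ eta x :=
      pow_le_of_le_one h0.le ((eta_le x).trans (by norm_num)) three_ne_zero
    have h2 : eta x * |w x| ≤ ε / 2 * eta x ^ 2 + 1 / (2 * ε) * w x ^ 2 := by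
      rw [← sq_abs (w x), ← sub_nonneg]
      have : ε / 2 * eta x ^ 2 + 1 / (2 * ε) * |w x| ^ 2 - eta x * |w x|
          = 1 / (2 * ε) * (|w x| - ε * eta x) ^ 2 := by
        field_simp
        ring
      rw [this]
      positivity
    exact (mul_le_mul_of_nonneg_right h1 (abs_nonneg _)).trans h2
  have h1 := norm_integral_le_of_norm_le
    ((integrable_eta_sq.const_mul (ε / 2)).add (h.2.1.const_mul (1 / (2 * ε))))
    (Eventually.of_forall hb)
  have e : ∫ x, (ε / 2 * eta x ^ 2 + 1 / (2 * ε) * w x ^ 2)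
      = ε / 2 + 1 / (2 * ε) * ∫ x, w x ^ 2 := by
    rw [integral_add (integrable_eta_sq.const_mul _) (h.2.1.const_mul _), integral_const_mul,
      integral_const_mul, integral_eta_sq, mul_one]
  refine h1.trans (e.le.trans ?_)
  have h2 : 1 / (2 * ε) * ∫ x, w x ^ 2 ≤ 1 / (2 * ε) * ε ^ 2 := by gcongr
  have h3 : 1 / (2 * ε) * ε ^ 2 = ε / 2 := by field_simp
  linarith

/-- The chemical potential `g` of a state, after one integration by parts. -/
lemma chemical_potential_eq {f f' f'' : ℝ → ℝ} (hf : HasL2Deriv f f') (hf' : HasL2Deriv f' f'') :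
    ∫ x, (-(1 / 2) * f'' x * f x - f x ^ 4) = 1 / 2 * (∫ x, f' x ^ 2) - ∫ x, f x ^ 4 := by
  have i1 : Integrable fun x => f'' x * f x :=
    integrable_mul_of_sq hf'.measurable' hf.measurable hf'.2.2 hf.2.1
  have e : (fun x => -(1 / 2) * f'' x * f x - f x ^ 4)
      = fun x => -(1 / 2) * (f'' x * f x) - f x ^ 4 := by
    funext x
    ring
  rw [e, integral_sub (i1.const_mul _) hf.integrable_pow_four, integral_const_mul,
    hf'.integral_deriv_mul hf]
  simp only [pow_two]
  ring

/-- Testing the flow against the state itself. -/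
lemma integral_mul_flow {f f' f'' : ℝ → ℝ} (hf : HasL2Deriv f f') (hf' : HasL2Deriv f' f'')
    (g : ℝ) :
    ∫ x, f x * (1 / 2 * f'' x + f x ^ 3 + g * f x)
      = g * (∫ x, f x * f x) - ∫ x, (-(1 / 2) * f'' x * f x - f x ^ 4) := by
  have i1 : Integrable fun x => f'' x * f x :=
    integrable_mul_of_sq hf'.measurable' hf.measurable hf'.2.2 hf.2.1
  have i2 : Integrable fun x => -(1 / 2) * f'' x * f x - f x ^ 4 := by
    refine ((i1.const_mul (-(1 / 2))).sub hf.integrable_pow_four).congr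
      (Eventually.of_forall fun x => ?_)
    simp only [Pi.sub_apply]
    ring
  rw [← integral_const_mul, ← integral_sub ((hf.integrable_mul hf).const_mul g) i2]
  congr 1
  funext x
  ring

section Expansion

variable {f f' f'' w v : ℝ → ℝ}

lemma integral_sq_add_eta (hw : HasL2Deriv w v) :
    ∫ x, (w x + eta x) ^ 2 = (∫ x, w x ^ 2) + 2 * (∫ x, w x * eta x) + 1 := by
  have e : (fun x => (w x + eta x) ^ 2)
      = fun x => w x ^ 2 + 2 * (w x * eta x) + eta x ^ 2 := by
    funext x
    ring
  have i1 := (hw.integrable_mul hasL2Deriv_eta).const_mul 2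
  have i2 : Integrable fun x => w x ^ 2 + 2 * (w x * eta x) := hw.2.1.add i1
  rw [e, integral_add i2 integrable_eta_sq, integral_add hw.2.1 i1, integral_const_mul,
    integral_eta_sq]

lemma integral_add_eta_mul_eta (hw : HasL2Deriv w v) :
    ∫ x, (w x + eta x) * eta x = (∫ x, w x * eta x) + 1 := by
  have e : (fun x => (w x + eta x) * eta x) = fun x => w x * eta x + eta x ^ 2 := by
    funext x
    ring
  rw [e, integral_add (hw.integrable_mul hasL2Deriv_eta) integrable_eta_sq, integral_eta_sq]

lemma integral_add_eta_mul_eta_cube (hw : HasL2Deriv w v) :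
    ∫ x, eta x ^ 3 * (w x + eta x) = (∫ x, eta x ^ 3 * w x) + 1 / 6 := by
  have e : (fun x => eta x ^ 3 * (w x + eta x)) = fun x => eta x ^ 3 * w x + eta x ^ 4 := by
    funext x
    ring
  rw [e, integral_add hw.integrable_eta_cube_mul integrable_eta_pow_four, integral_eta_pow_four]

lemma integral_eta_mul_add_eta_cube (hw : HasL2Deriv w v) :
    ∫ x, eta x * (w x + eta x) ^ 3 = (∫ x, eta x * w x ^ 3) + 3 * (∫ x, eta x ^ 2 * w x ^ 2)
      + 3 * (∫ x, eta x ^ 3 * w x) + 1 / 6 := by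
  have e : (fun x => eta x * (w x + eta x) ^ 3) = fun x => eta x * w x ^ 3
      + 3 * (eta x ^ 2 * w x ^ 2) + 3 * (eta x ^ 3 * w x) + eta x ^ 4 := by
    funext x
    ring
  have i1 := hw.integrable_eta_sq_mul_sq.const_mul 3
  have i2 := hw.integrable_eta_cube_mul.const_mul 3
  have i3 : Integrable fun x => eta x * w x ^ 3 + 3 * (eta x ^ 2 * w x ^ 2) :=
    hw.integrable_eta_mul_cube.add i1
  have i4 : Integrable fun x => eta x * w x ^ 3 + 3 * (eta x ^ 2 * w x ^ 2)
      + 3 * (eta x ^ 3 * w x) := i3.add i2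
  rw [e, integral_add i4 integrable_eta_pow_four, integral_add i3 i2,
    integral_add hw.integrable_eta_mul_cube i1, integral_const_mul, integral_const_mul,
    integral_eta_pow_four]

lemma integral_add_eta_pow_four (hw : HasL2Deriv w v) :
    ∫ x, (w x + eta x) ^ 4 = (∫ x, w x ^ 4) + 4 * (∫ x, eta x * w x ^ 3)
      + 6 * (∫ x, eta x ^ 2 * w x ^ 2) + 4 * (∫ x, eta x ^ 3 * w x) + 1 / 6 := by
  have e : (fun x => (w x + eta x) ^ 4) = fun x => w x ^ 4 + 4 * (eta x * w x ^ 3)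
      + 6 * (eta x ^ 2 * w x ^ 2) + 4 * (eta x ^ 3 * w x) + eta x ^ 4 := by
    funext x
    ring
  have i0 := hw.integrable_eta_mul_cube.const_mul 4
  have i1 := hw.integrable_eta_sq_mul_sq.const_mul 6
  have i2 := hw.integrable_eta_cube_mul.const_mul 4
  have i3 : Integrable fun x => w x ^ 4 + 4 * (eta x * w x ^ 3) := hw.integrable_pow_four.add i0
  have i4 : Integrable fun x => w x ^ 4 + 4 * (eta x * w x ^ 3) + 6 * (eta x ^ 2 * w x ^ 2) :=
    i3.add i1
  have i5 : Integrable fun x => w x ^ 4 + 4 * (eta x * w x ^ 3) + 6 * (eta x ^ 2 * w x ^ 2)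
      + 4 * (eta x ^ 3 * w x) := i4.add i2
  rw [e, integral_add i5 integrable_eta_pow_four, integral_add i4 i2, integral_add i3 i1,
    integral_add hw.integrable_pow_four i0, integral_const_mul, integral_const_mul,
    integral_const_mul, integral_eta_pow_four]

/-- Pairing a state with `η''`, rewritten through the ground state equation. -/
lemma integral_mul_deriv_deriv_eta (hf : HasL2Deriv f f') :
    ∫ x, f x * (1 / 4 * eta x - 2 * eta x ^ 3)
      = 1 / 4 * (∫ x, f x * eta x) - 2 * ∫ x, eta x ^ 3 * f x := by
  have e : (fun x => f x * (1 / 4 * eta x - 2 * eta x ^ 3))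
      = fun x => 1 / 4 * (f x * eta x) - 2 * (eta x ^ 3 * f x) := by
    funext x
    ring
  rw [e, integral_sub ((hf.integrable_mul hasL2Deriv_eta).const_mul _)
    (hf.integrable_eta_cube_mul.const_mul _), integral_const_mul, integral_const_mul]

lemma hasL2Deriv_deriv_eta :
    HasL2Deriv (fun x => -(1 / 2) * Real.tanh (x / 2) * eta x)
      (fun x => 1 / 4 * eta x - 2 * eta x ^ 3) := by
  refine ⟨hasDerivAt_deriv_eta, hasL2Deriv_eta.2.2, ?_⟩
  refine integrable_eta_sq.mono' ?_ (Eventually.of_forall fun x => ?_)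
  · exact (((continuous_eta.const_mul _).sub ((continuous_eta.pow 3).const_mul _)).pow
      2).aestronglyMeasurable
  · rw [Real.norm_of_nonneg (sq_nonneg _)]
    have h0 := eta_pos x
    have h1 := eta_le x
    have h2 : eta x ^ 2 ≤ 1 / 4 := by nlinarith
    have h3 : (1 / 4 - 2 * eta x ^ 2) ^ 2 ≤ 1 := by nlinarith [sq_nonneg (eta x)]
    calc (1 / 4 * eta x - 2 * eta x ^ 3) ^ 2 = (1 / 4 - 2 * eta x ^ 2) ^ 2 * eta x ^ 2 := by ring
      _ ≤ 1 * eta x ^ 2 := by gcongr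
      _ = eta x ^ 2 := one_mul _

lemma integral_deriv_eta_sq :
    ∫ x, (-(1 / 2) * Real.tanh (x / 2) * eta x) ^ 2 = 1 / 12 := by
  have h := hasL2Deriv_deriv_eta.integral_deriv_mul hasL2Deriv_eta
  have h2 := integral_mul_deriv_deriv_eta hasL2Deriv_eta
  have e1 : ∫ x, eta x * eta x = 1 := by simpa only [pow_two] using integral_eta_sq
  have e2 : ∫ x, eta x ^ 3 * eta x = 1 / 6 := by
    simpa only [← pow_succ] using integral_eta_pow_four
  rw [e1, e2] at h2
  simp only [pow_two]
  have e3 : ∫ x, (1 / 4 * eta x - 2 * eta x ^ 3) * eta x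
      = ∫ x, eta x * (1 / 4 * eta x - 2 * eta x ^ 3) := by
    simp only [mul_comm]
  linarith

lemma integral_deriv_add_eta_sq (hw : HasL2Deriv w v) :
    ∫ x, (v x + -(1 / 2) * Real.tanh (x / 2) * eta x) ^ 2
      = (∫ x, v x ^ 2) + 2 * (2 * (∫ x, eta x ^ 3 * w x) - 1 / 4 * ∫ x, w x * eta x)
        + 1 / 12 := by
  set n' : ℝ → ℝ := fun x => -(1 / 2) * Real.tanh (x / 2) * eta x with hn'
  have hn : HasL2Deriv n' _ := hasL2Deriv_deriv_eta
  have e : (fun x => (v x + n' x) ^ 2) = fun x => v x ^ 2 + 2 * (v x * n' x) + n' x ^ 2 := by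
    funext x
    ring
  have i1 := (integrable_mul_of_sq hw.measurable' hn.measurable hw.2.2 hn.2.1).const_mul 2
  have i2 : Integrable fun x => v x ^ 2 + 2 * (v x * n' x) := hw.2.2.add i1
  have h : ∫ x, (v x + n' x) ^ 2 = (∫ x, v x ^ 2) + 2 * (∫ x, v x * n' x) + ∫ x, n' x ^ 2 := by
    rw [e, integral_add i2 hn.2.1, integral_add hw.2.2 i1, integral_const_mul]
  rw [h, hw.integral_deriv_mul hn, integral_mul_deriv_deriv_eta hw, hn', integral_deriv_eta_sq]
  ring

/-- Testing the flow against the ground state. -/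
lemma integral_flow_mul_eta (hf : HasL2Deriv f f') (hf' : HasL2Deriv f' f'') (g : ℝ) :
    ∫ x, (1 / 2 * f'' x + f x ^ 3 + g * f x) * eta x
      = 1 / 2 * (1 / 4 * (∫ x, f x * eta x) - 2 * ∫ x, eta x ^ 3 * f x)
        + (∫ x, eta x * f x ^ 3) + g * ∫ x, f x * eta x := by
  have e : (fun x => (1 / 2 * f'' x + f x ^ 3 + g * f x) * eta x)
      = fun x => 1 / 2 * (f'' x * eta x) + eta x * f x ^ 3 + g * (f x * eta x) := by
    funext x
    ring
  have i1 := (integrable_mul_of_sq hf'.measurable' hasL2Deriv_eta.measurable hf'.2.2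
    hasL2Deriv_eta.2.1).const_mul (1 / 2)
  have i2 : Integrable fun x => 1 / 2 * (f'' x * eta x) + eta x * f x ^ 3 :=
    i1.add hf.integrable_eta_mul_cube
  rw [e, integral_add i2 ((hf.integrable_mul hasL2Deriv_eta).const_mul g),
    integral_add i1 hf.integrable_eta_mul_cube, integral_const_mul, integral_const_mul,
    hf'.integral_deriv_mul hasL2Deriv_eta, hf.integral_deriv_mul hasL2Deriv_deriv_eta, neg_neg,
    integral_mul_deriv_deriv_eta hf]

end Expansion

/-- The differential inequality for the squared distance to the ground state: on even states of
unit mass close to `η`, the flow contracts this distance at a linear rate. -/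
lemma neg_two_mul_integral_flow_mul_eta_le {f f' f'' : ℝ → ℝ} (hf : HasL2Deriv f f')
    (hf' : HasL2Deriv f' f'') (heven : ∀ x, f (-x) = f x) (hmass : ∫ x, f x ^ 2 = 1)
    (hm : ∫ x, (f x - eta x) ^ 2 ≤ (1 / 1000000) ^ 2) :
    -2 * ∫ x, (1 / 2 * f'' x + f x ^ 3
        + (∫ y, (-(1 / 2) * f'' y * f y - f y ^ 4)) * f x) * eta x
      ≤ -(1 / 20000) * ∫ x, (f x - eta x) ^ 2 := by
  set w : ℝ → ℝ := fun x => f x - eta x with hw_def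
  set v : ℝ → ℝ := fun x => f' x - -(1 / 2) * Real.tanh (x / 2) * eta x with hv_def
  have hw : HasL2Deriv w v := hf.sub hasL2Deriv_eta
  have hfw : ∀ x, f x = w x + eta x := fun x => by simp [hw_def]
  have hfv : ∀ x, f' x = v x + -(1 / 2) * Real.tanh (x / 2) * eta x := fun x => by simp [hv_def]
  have hweven : ∀ x, w (-x) = w x := fun x => by simp only [hw_def, heven, eta_neg]
  rw [integral_flow_mul_eta hf hf', chemical_potential_eq hf hf']
  have e1 := integral_sq_add_eta hw
  have e2 := integral_add_eta_mul_eta hw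
  have e3 := integral_add_eta_mul_eta_cube hw
  have e4 := integral_eta_mul_add_eta_cube hw
  have e5 := integral_add_eta_pow_four hw
  have e6 := integral_deriv_add_eta_sq hw
  simp only [← hfw, ← hfv] at e1 e2 e3 e4 e5 e6
  have hε : (0 : ℝ) < 1 / 1000000 := by norm_num
  have b1 := hw.abs_integral_eta_mul_cube_le hε hm
  have b2 := hw.abs_integral_eta_cube_mul_le hε hm
  have b3 := hw.integral_pow_four_le
  have b4 := coercive hw hweven
  have p1 : 0 ≤ ∫ x, w x ^ 2 := integral_nonneg fun x => sq_nonneg _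
  have p2 : 0 ≤ ∫ x, v x ^ 2 := integral_nonneg fun x => sq_nonneg _
  have p3 : 0 ≤ ∫ x, eta x ^ 2 * w x ^ 2 := integral_nonneg fun x => by positivity
  have p4 : 0 ≤ ∫ x, w x ^ 4 := integral_nonneg fun x => by positivity
  rw [hmass] at e1
  rw [e2, e3, e4, e5, e6]
  change _ ≤ -(1 / 20000) * ∫ x, w x ^ 2
  change ∫ x, w x ^ 2 ≤ _ at hm
  generalize (∫ x, w x ^ 2) = m at *
  generalize (∫ x, v x ^ 2) = D at *
  generalize (∫ x, eta x ^ 2 * w x ^ 2) = J at *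
  generalize (∫ x, eta x * w x ^ 3) = C at *
  generalize (∫ x, eta x ^ 3 * w x) = L at *
  generalize (∫ x, w x ^ 4) = R at *
  generalize (∫ x, w x * eta x) = a at *
  obtain rfl : m = -2 * a := by linarith
  obtain ⟨b1l, b1r⟩ := abs_le.1 b1
  obtain ⟨b2l, b2r⟩ := abs_le.1 b2
  have q1 : (-2 * a) * (D - 2 * a) ≤ (1 / 1000000) ^ 2 * (D - 2 * a) :=
    mul_le_mul_of_nonneg_right hm (by linarith)
  have q2 : (-2 * a) * -C ≤ 1 / 1000000 * (-2 * a + D) := by nlinarith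
  have q3 : (-2 * a) * -L ≤ (-2 * a) * (1 / 1000000) :=
    mul_le_mul_of_nonneg_left (by linarith) p1
  have q4 : 0 ≤ (-2 * a) * J := mul_nonneg p1 p3
  have q5 : 0 ≤ (-2 * a) * R := mul_nonneg p1 p4
  have q6 : 0 ≤ (-2 * a) * D := mul_nonneg p1 p2
  nlinarith

/-- A nonnegative quantity that decays at rate `κ` below a threshold, and starts below it, decays
exponentially. -/
lemma le_mul_exp_of_hasDerivAt {M M' : ℝ → ℝ} {κ B : ℝ} (hκ : 0 < κ) (hB : 0 < B)
    (hM : ∀ t, 0 ≤ t → HasDerivAt M (M' t) t) (h0 : M 0 ≤ B)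
    (hM' : ∀ t, 0 ≤ t → M t ≤ B → M' t ≤ -κ * M t) {t : ℝ} (ht : 0 ≤ t) :
    M t ≤ M 0 * Real.exp (-κ * t) := by
  have hsmall : ∀ t, 0 ≤ t → M t ≤ B := fun T hT =>
    image_le_of_deriv_right_lt_deriv_boundary (a := 0) (b := T) (B := fun _ => B)
      (B' := fun _ => 0)
      (fun s hs => (hM s hs.1).continuousAt.continuousWithinAt)
      (fun s hs => (hM s hs.1).hasDerivWithinAt) h0 (fun s => hasDerivAt_const s B)
      (fun s hs e => by
        have := hM' s hs.1 e.le
        rw [e] at this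
        nlinarith) (right_mem_Icc.2 hT)
  have hd : ∀ s, 0 ≤ s → HasDerivAt (fun s => M s * Real.exp (κ * s))
      ((M' s + κ * M s) * Real.exp (κ * s)) s := fun s hs => by
    have he : HasDerivAt (fun s => Real.exp (κ * s)) (Real.exp (κ * s) * κ) s := by
      simpa using ((hasDerivAt_id s).const_mul κ).exp
    refine ((hM s hs).fun_mul he).congr_deriv ?_
    ring
  have hanti : AntitoneOn (fun s => M s * Real.exp (κ * s)) (Ici 0) := by
    refine antitoneOn_of_hasDerivWithinAt_nonpos (convex_Ici 0)
      (fun s hs => (hd s hs).continuousAt.continuousWithinAt)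
      (fun s hs => (hd s (interior_subset hs)).hasDerivWithinAt) fun s hs => ?_
    have hs' : 0 ≤ s := interior_subset hs
    exact mul_nonpos_of_nonpos_of_nonneg
      (by linarith [hM' s hs' (hsmall s hs')]) (Real.exp_pos _).le
  have h := hanti self_mem_Ici ht ht
  simp only [mul_zero, Real.exp_zero, mul_one] at h
  rwa [neg_mul, Real.exp_neg, ← div_eq_mul_inv, le_div_iff₀ (Real.exp_pos _)]

/-- A solution of a linear equation with locally bounded coefficient that vanishes initially
vanishes identically. -/
lemma eq_zero_of_hasDerivAt_mul {n g G : ℝ → ℝ} (hn : ∀ t, 0 ≤ t → HasDerivAt n (g t * n t) t)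
    (hG : ContinuousOn G (Ici 0)) (hgG : ∀ t, 0 ≤ t → |g t| ≤ G t) (h0 : n 0 = 0) {t : ℝ}
    (ht : 0 ≤ t) : n t = 0 := by
  obtain ⟨K, hK⟩ := isCompact_Icc.exists_bound_of_continuousOn
    (hG.mono (Icc_subset_Ici_self : Icc 0 t ⊆ Ici 0))
  refine eq_zero_of_abs_deriv_le_mul_abs_self_of_eq_zero_right (K := K)
    (fun s hs => (hn s hs.1).continuousAt.continuousWithinAt)
    (fun s hs => (hn s hs.1).hasDerivWithinAt) h0 (fun s hs => ?_) t (right_mem_Icc.2 ht)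
  rw [norm_mul]
  refine mul_le_mul_of_nonneg_right ?_ (norm_nonneg _)
  exact (hgG s hs.1).trans ((le_abs_self _).trans (hK s (Ico_subset_Icc_self hs)))

lemma abs_chemical_potential_le {f f' f'' : ℝ → ℝ} (hf : HasL2Deriv f f')
    (hf' : HasL2Deriv f' f'') :
    |∫ x, (-(1 / 2) * f'' x * f x - f x ^ 4)| ≤ 1 / 2 * (∫ x, f' x ^ 2)
      + ((∫ x, f x ^ 2) + ∫ x, f' x ^ 2) * ∫ x, f x ^ 2 := by
  rw [chemical_potential_eq hf hf']
  have h1 : 0 ≤ ∫ x, f' x ^ 2 := integral_nonneg fun x => sq_nonneg _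
  have h2 : 0 ≤ ∫ x, f x ^ 4 := integral_nonneg fun x => by positivity
  have h3 := hf.integral_pow_four_le
  exact abs_le.2 ⟨by linarith, by linarith⟩

lemma integral_sub_eta_sq {f f' : ℝ → ℝ} (hf : HasL2Deriv f f') (hmass : ∫ x, f x ^ 2 = 1) :
    ∫ x, (f x - eta x) ^ 2 = 2 - 2 * ∫ x, f x * eta x := by
  have hw := hf.sub hasL2Deriv_eta
  have e1 := integral_sq_add_eta hw
  have e2 := integral_add_eta_mul_eta hw
  simp only [sub_add_cancel] at e1 e2
  linarith

lemma HasL2Deriv.integral_sq_le_H1sq {f f' : ℝ → ℝ} (hf : HasL2Deriv f f') :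
    ∫ x, f x ^ 2 ≤ H1sq f := by
  have e : deriv f = f' := funext fun x => (hf.1 x).deriv
  rw [H1sq, e, integral_add hf.2.1 hf.2.2]
  have : 0 ≤ ∫ x, f' x ^ 2 := integral_nonneg fun x => sq_nonneg _
  linarith

/-- exponential convergence of the continuous normalized gradient flow
(Theorem 3.1): there exist `δ > 0` and `μ > 0` such that any solution of
`∂ₜψ = (1/2)∂ₓₓψ + ψ³ + g(t)ψ`, `g(t) = ∫(−(1/2)∂ₓₓψ·ψ − ψ⁴)`, which is even, on the unit
`L²` sphere, and starts `δ`-close to `η` in `H¹`, converges exponentially to `η` in `L²`. -/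
theorem normalized_gradient_flow_converges :
    ∃ δ μ : ℝ, 0 < δ ∧ 0 < μ ∧
      ∀ ψ : ℝ → ℝ → ℝ,
        (∀ t : ℝ, ∀ x : ℝ, ψ t (-x) = ψ t x) →
        (∀ t : ℝ, Differentiable ℝ (ψ t) ∧ Differentiable ℝ (deriv (ψ t))) →
        (∀ t : ℝ, Integrable (fun x => (ψ t x)^2) ∧
          Integrable (fun x => (deriv (ψ t) x)^2) ∧
          Integrable (fun x => (deriv (deriv (ψ t)) x)^2)) →
        (∀ x : ℝ, Differentiable ℝ (fun t => ψ t x)) →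
        -- differentiation under the integral sign for t ↦ ∫ ψ(t)·φ,
        -- for φ ∈ {ψ(t), η, ψ(t) − η}
        (∀ t : ℝ, 0 ≤ t →
          HasDerivAt (fun s : ℝ => ∫ x : ℝ, ψ s x * ψ s x)
            (2 * ∫ x : ℝ, ψ t x * deriv (fun s => ψ s x) t) t ∧
          HasDerivAt (fun s : ℝ => ∫ x : ℝ, ψ s x * eta x)
            (∫ x : ℝ, deriv (fun s => ψ s x) t * eta x) t ∧
          HasDerivAt (fun s : ℝ => ∫ x : ℝ, ψ s x * (ψ s x - eta x))
            (∫ x : ℝ, deriv (fun s => ψ s x) t * (2 * ψ t x - eta x)) t) →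
        -- differentiation under the integral sign for t ↦ ∫ ∂ₓψ(t)·∂ₓφ,
        -- for φ ∈ {ψ(t), η, ψ(t) − η}
        (∀ t : ℝ, 0 ≤ t →
          HasDerivAt (fun s : ℝ => ∫ x : ℝ, deriv (ψ s) x * deriv (ψ s) x)
            (2 * ∫ x : ℝ, deriv (ψ t) x * deriv (fun s => deriv (ψ s) x) t) t ∧
          HasDerivAt (fun s : ℝ => ∫ x : ℝ, deriv (ψ s) x * deriv eta x)
            (∫ x : ℝ, deriv (fun s => deriv (ψ s) x) t * deriv eta x) t ∧
          HasDerivAt (fun s : ℝ => ∫ x : ℝ, deriv (ψ s) x * (deriv (ψ s) x - deriv eta x))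
            (∫ x : ℝ, deriv (fun s => deriv (ψ s) x) t *
              (2 * deriv (ψ t) x - deriv eta x)) t) →
        (∫ x : ℝ, (ψ 0 x)^2) = 1 →
        (∀ t : ℝ, 0 ≤ t → ∀ x : ℝ,
          deriv (fun s => ψ s x) t =
            (1/2) * deriv (deriv (ψ t)) x + (ψ t x)^3 +
              (∫ y : ℝ, (-(1/2) * deriv (deriv (ψ t)) y * ψ t y - (ψ t y)^4)) * ψ t x) →
        Real.sqrt (H1sq (fun x => ψ 0 x - eta x)) ≤ δ →
        ∃ C : ℝ, 0 ≤ C ∧ ∀ t : ℝ, 0 ≤ t →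
          Real.sqrt (∫ x : ℝ, (ψ t x - eta x)^2) ≤ C * Real.exp (-μ * t) := by
  refine ⟨1 / 10000000, 1 / 40000, by norm_num, by norm_num, ?_⟩
  intro ψ heven hdiff hsq _ hL hH hmass0 hpde hinit
  have hψ : ∀ t, HasL2Deriv (ψ t) (deriv (ψ t)) := fun t =>
    ⟨fun x => ((hdiff t).1 x).hasDerivAt, (hsq t).1, (hsq t).2.1⟩
  have hψ' : ∀ t, HasL2Deriv (deriv (ψ t)) (deriv (deriv (ψ t))) := fun t =>
    ⟨fun x => ((hdiff t).2 x).hasDerivAt, (hsq t).2.1, (hsq t).2.2⟩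
  have hN : ∀ t, 0 ≤ t → HasDerivAt (fun s => (∫ x, ψ s x ^ 2) - 1)
      ((2 * ∫ y, (-(1 / 2) * deriv (deriv (ψ t)) y * ψ t y - ψ t y ^ 4))
        * ((∫ x, ψ t x ^ 2) - 1)) t := fun t ht => by
    have h := (hL t ht).1
    simp only [hpde t ht, integral_mul_flow (hψ t) (hψ' t), ← pow_two] at h
    refine (h.sub_const 1).congr_deriv ?_
    ring
  have hmass : ∀ t, 0 ≤ t → ∫ x, ψ t x ^ 2 = 1 := fun t ht => by
    have c1 : ContinuousOn (fun s => ∫ x, ψ s x ^ 2) (Ici 0) := fun s hs => by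
      simpa only [pow_two] using (hL s hs).1.continuousAt.continuousWithinAt
    have c2 : ContinuousOn (fun s => ∫ x, deriv (ψ s) x ^ 2) (Ici 0) := fun s hs => by
      simpa only [pow_two] using (hH s hs).1.continuousAt.continuousWithinAt
    have := eq_zero_of_hasDerivAt_mul hN
      (((c2.const_mul (1 / 2)).add ((c1.add c2).mul c1)).const_mul 2)
      (fun s _ => by
        rw [abs_mul, abs_two]
        exact mul_le_mul_of_nonneg_left (abs_chemical_potential_le (hψ s) (hψ' s)) two_pos.le)
      (by rw [hmass0, sub_self]) ht
    linarith
  have hdist : ∀ t, 0 ≤ t → ∫ x, (ψ t x - eta x) ^ 2 = 2 - 2 * ∫ x, ψ t x * eta x :=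
    fun t ht => integral_sub_eta_sq (hψ t) (hmass t ht)
  have h0 : ∫ x, (ψ 0 x - eta x) ^ 2 ≤ (1 / 1000000) ^ 2 := by
    have h1 := ((hψ 0).sub hasL2Deriv_eta).integral_sq_le_H1sq
    have h2 := Real.sqrt_le_iff.1 hinit
    linarith [h2.2]
  have hdecay : ∀ t, 0 ≤ t → ∫ x, (ψ t x - eta x) ^ 2
      ≤ (∫ x, (ψ 0 x - eta x) ^ 2) * Real.exp (-(1 / 20000) * t) := fun t ht => by
    rw [hdist 0 le_rfl] at h0 ⊢
    rw [hdist t ht]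
    refine le_mul_exp_of_hasDerivAt (M := fun t => 2 - 2 * ∫ x, ψ t x * eta x)
      (M' := fun t => -(2 * ∫ x, deriv (fun s => ψ s x) t * eta x)) (by norm_num) (by norm_num)
      (fun s hs => ((hL s hs).2.1.const_mul 2).const_sub 2) h0 (fun s hs hB => ?_) ht
    have h := neg_two_mul_integral_flow_mul_eta_le (hψ s) (hψ' s) (heven s) (hmass s hs)
      (by rwa [hdist s hs])
    simp only [hpde s hs]
    rw [hdist s hs] at h
    linarith
  refine ⟨Real.sqrt (∫ x, (ψ 0 x - eta x) ^ 2), Real.sqrt_nonneg _, fun t ht => ?_⟩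
  refine (Real.sqrt_le_sqrt (hdecay t ht)).trans_eq ?_
  rw [Real.sqrt_mul (integral_nonneg fun x => sq_nonneg _), ← Real.exp_half]
  ring_nf
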